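/- Let G be a group, let X be a strongly slide-free G-tree and Y a proper G-tree, both cocompact, and suppose all vertex stabilizers (of both trees) are unsplittable. If either (1) one of the trees has vertex stabilizers with property (FA), or (2) one of the trees is locally finite, then there is a unique isomorphism of G-trees X → Y. -/

import Mathlib

universe u

/-- A `G`-tree: a simplicial tree together with an action of `G` by graph
automorphisms without inversions. -/
structure GTree (G : Type u) [Group G] : Type (u + 1) where
  V : Type u
  graph : SimpleGraph V
  isTree : graph.IsTree
  smul : G → V → V
  smul_one : ∀ x, smul 1 x = x
  smul_mul : ∀ γ δ x, smul (γ * δ) x = smul γ (smul δ x)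
  smul_adj : ∀ (γ : G) ⦃x y : V⦄, graph.Adj x y → graph.Adj (smul γ x) (smul γ y)
  no_inversions : ∀ (γ : G) (x y : V), graph.Adj x y → ¬(smul γ x = y ∧ smul γ y = x)

namespace GTree

variable {G : Type u} [Group G]

/-- Oriented edges of a `G`-tree. -/
def Edge (X : GTree G) : Type u := { p : X.V × X.V // X.graph.Adj p.1 p.2 }

/-- Initial vertex `∂₀ e` of an oriented edge. -/
def d0 {X : GTree G} (e : X.Edge) : X.V := e.1.1

/-- Terminal vertex `∂₁ e` of an oriented edge. -/
def d1 {X : GTree G} (e : X.Edge) : X.V := e.1.2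

/-- The underlying geometric (unoriented) edge. -/
def esym {X : GTree G} (e : X.Edge) : Sym2 X.V := s(e.1.1, e.1.2)

/-- Action of `G` on oriented edges. -/
def edgeSmul {X : GTree G} (γ : G) (e : X.Edge) : X.Edge :=
  ⟨(X.smul γ e.1.1, X.smul γ e.1.2), X.smul_adj γ e.2⟩

/-- Vertex stabilizer `G_x`. -/
def stab (X : GTree G) (x : X.V) : Subgroup G where
  carrier := { γ | X.smul γ x = x }
  one_mem' := X.smul_one x
  mul_mem' := by
    intro a b ha hb
    simp only [Set.mem_setOf_eq] at *
    rw [X.smul_mul, hb, ha]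
  inv_mem' := by
    intro a ha
    simp only [Set.mem_setOf_eq] at *
    conv_lhs => rw [← ha]
    rw [← X.smul_mul, inv_mul_cancel, X.smul_one]

/-- Edge stabilizer `G_e`: the elements fixing both endpoints (since the action
is without inversions, these are exactly the elements fixing the edge). -/
def edgeStab (X : GTree G) (e : X.Edge) : Subgroup G :=
  X.stab (d0 e) ⊓ X.stab (d1 e)

/-- An element of `G` is elliptic if it fixes a vertex. -/
def Elliptic (X : GTree G) (γ : G) : Prop := ∃ x, X.smul γ x = x

/-- A subgroup of `G` is elliptic if it fixes a vertex. -/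
def FixesVertex (X : GTree G) (H : Subgroup G) : Prop := ∃ x, ∀ γ ∈ H, X.smul γ x = x

/-- Two `G`-trees have the same elliptic subgroups. -/
def SameEllipticSubgroups (X Y : GTree G) : Prop :=
  ∀ H : Subgroup G, X.FixesVertex H ↔ Y.FixesVertex H

/-- The length function `ℓ_X(γ)`: the minimal vertex displacement. -/
noncomputable def transLen (X : GTree G) (γ : G) : ℕ :=
  sInf (Set.range fun x => X.graph.dist x (X.smul γ x))

/-- Cocompact: the quotient graph `G\X` is finite, i.e. there are finitely
many orbits of vertices and of edges. -/
def Cocompact (X : GTree G) : Prop :=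
  Finite (Quot fun x y : X.V => ∃ γ, X.smul γ x = y) ∧
    Finite (Quot fun e f : X.Edge => ∃ γ, edgeSmul γ e = f)

/-- Reduced: whenever `G_e = G_{∂₀ e}`, the endpoints of `e` are in the same
`G`-orbit. -/
def Reduced (X : GTree G) : Prop :=
  ∀ e : X.Edge, X.edgeStab e = X.stab (d0 e) → ∃ γ, X.smul γ (d0 e) = d1 e

/-- A nonempty `G`-invariant subtree (a nonempty invariant set of vertices that
is connected in the induced graph). -/
def IsInvariantSubtree (X : GTree G) (S : Set X.V) : Prop :=
  S.Nonempty ∧ (∀ γ, ∀ x ∈ S, X.smul γ x ∈ S) ∧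
    ∀ x ∈ S, ∀ y ∈ S, ∃ p : X.graph.Walk x y, ∀ v ∈ p.support, v ∈ S

/-- Minimal: there is no proper nonempty invariant subtree. -/
def Minimal (X : GTree G) : Prop :=
  ∀ S : Set X.V, X.IsInvariantSubtree S → S = Set.univ

/-- Strongly slide-free: minimal, and for all edges `e`, `f` with
`∂₀ e = ∂₀ f`, the inclusion `G_e ⊆ G_f` implies `f ∈ G e`. -/
def StronglySlideFree (X : GTree G) : Prop :=
  X.Minimal ∧ ∀ e f : X.Edge, d0 e = d0 f → X.edgeStab e ≤ X.edgeStab f →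
    ∃ γ, edgeSmul γ e = f

/-- Proper: `G_e ⊊ G_{∂₀ e}` for every edge `e`. -/
def Proper (X : GTree G) : Prop := ∀ e : X.Edge, X.edgeStab e < X.stab (d0 e)

/-- Locally finite: every vertex has finite valence. -/
def LocallyFinite (X : GTree G) : Prop := ∀ x : X.V, (X.graph.neighborSet x).Finite

/-- `φ` is an isomorphism of `G`-trees: an equivariant graph isomorphism. -/
def IsGIso (X Y : GTree G) (φ : X.V → Y.V) : Prop :=
  Function.Bijective φ ∧ (∀ x y, X.graph.Adj x y ↔ Y.graph.Adj (φ x) (φ y)) ∧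
    ∀ γ x, φ (X.smul γ x) = Y.smul γ (φ x)

/-- `φ : X → Y` is the collapse move performed at (the orbit of) the edge `e`:
`G_e = G_{∂₀ e}`, the endpoints of `e` lie in different `G`-orbits, and `Y` is
the equivariant quotient of `X` identifying `∂₀(γ e)` with `∂₁(γ e)` for all
`γ ∈ G`. -/
def IsCollapse (X Y : GTree G) (φ : X.V → Y.V) (e : X.Edge) : Prop :=
  X.edgeStab e = X.stab (d0 e) ∧
  (∀ γ : G, X.smul γ (d0 e) ≠ d1 e) ∧
  Function.Surjective φ ∧
  (∀ γ x, φ (X.smul γ x) = Y.smul γ (φ x)) ∧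
  (∀ u v : X.V, φ u = φ v ↔
    Relation.EqvGen (fun a b => ∃ γ : G, a = X.smul γ (d0 e) ∧ b = X.smul γ (d1 e)) u v) ∧
  (∀ a b : Y.V, a ≠ b → (Y.graph.Adj a b ↔ ∃ u v, X.graph.Adj u v ∧ φ u = a ∧ φ v = b))

/-- `Y` is obtained from `X` by a collapse move. -/
def Collapse (X Y : GTree G) : Prop := ∃ (φ : X.V → Y.V) (e : X.Edge), IsCollapse X Y φ e

/-- Elementary deformation: a finite composition of collapse moves and their
inverses (expansion moves). -/
def ElemDeformation : GTree G → GTree G → Prop := Relation.EqvGen Collapse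

end GTree

/-- A group `H` is unsplittable if in every `H`-tree every element of `H` is
elliptic. -/
def Unsplittable (H : Type u) [Group H] : Prop :=
  ∀ T : GTree H, ∀ h : H, T.Elliptic h

/-- A group `H` has property (FA) if every `H`-tree has a global fixed
point. -/
def PropertyFA (H : Type u) [Group H] : Prop :=
  ∀ T : GTree H, ∃ v : T.V, ∀ h : H, T.smul h v = v

namespace SimpleGraph.IsTree

variable {V : Type*} {T : SimpleGraph V}

theorem exists_adj_dist_add_one (hT : T.IsTree) {u v : V} (h : u ≠ v) :
    ∃ n, T.Adj u n ∧ T.dist n v + 1 = T.dist u v := by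
  obtain ⟨p, hp⟩ := hT.connected.exists_walk_length_eq_dist u v
  cases p with
  | nil => exact absurd rfl h
  | @cons _ n _ hn q =>
    refine ⟨n, hn, ?_⟩
    have h1 := dist_le q
    have h2 := hT.connected.dist_triangle (u := u) (v := n) (w := v)
    have h3 := dist_eq_one_iff_adj.2 hn
    simp only [Walk.length_cons] at hp
    omega

theorem adj_unique (hT : T.IsTree) {u v n n' : V} (hn : T.Adj u n) (hn' : T.Adj u n')
    (h : T.dist n v + 1 = T.dist u v) (h' : T.dist n' v + 1 = T.dist u v) : n = n' := by
  obtain ⟨p, hp⟩ := hT.connected.exists_walk_length_eq_dist n v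
  obtain ⟨p', hp'⟩ := hT.connected.exists_walk_length_eq_dist n' v
  have hq : (Walk.cons hn p).IsPath :=
    Walk.isPath_of_length_eq_dist _ (by rw [Walk.length_cons, hp, h])
  have hq' : (Walk.cons hn' p').IsPath :=
    Walk.isPath_of_length_eq_dist _ (by rw [Walk.length_cons, hp', h'])
  have := congrArg Walk.snd
    (congrArg Subtype.val ((hT.isAcyclic.subsingleton_path _ _).elim ⟨_, hq⟩ ⟨_, hq'⟩))
  simpa using this

theorem dist_adj (hT : T.IsTree) {u n : V} (hn : T.Adj u n) (v : V) :
    T.dist n v + 1 = T.dist u v ∨ T.dist n v = T.dist u v + 1 := by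
  have := hT.dist_eq_dist_add_one_of_adj v hn
  rw [T.dist_comm (u := n), T.dist_comm (u := u)]
  tauto

theorem exists_dist_eq (hT : T.IsTree) {u v : V} {k : ℕ} (hk : k ≤ T.dist u v) :
    ∃ p, T.dist u p = k ∧ T.dist u p + T.dist p v = T.dist u v := by
  induction k with
  | zero => exact ⟨u, by simp⟩
  | succ k ih =>
    obtain ⟨p, hp, hpv⟩ := ih (by omega)
    have hne : p ≠ v := by
      rintro rfl
      omega
    obtain ⟨n, hn, hnv⟩ := hT.exists_adj_dist_add_one hne
    have h1 := hT.connected.dist_triangle (u := u) (v := p) (w := n)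
    have h2 := hT.connected.dist_triangle (u := u) (v := n) (w := v)
    have h3 := dist_eq_one_iff_adj.2 hn
    exact ⟨n, by omega, by omega⟩

theorem eq_of_dist_eq (hT : T.IsTree) {u v p q : V}
    (hp : T.dist u p + T.dist p v = T.dist u v) (hq : T.dist u q + T.dist q v = T.dist u v)
    (h : T.dist u p = T.dist u q) : p = q := by
  induction hk : T.dist u p generalizing u with
  | zero =>
    exact (hT.connected.dist_eq_zero_iff.1 hk).symm.trans
      (hT.connected.dist_eq_zero_iff.1 (h ▸ hk))
  | succ k ih =>
    have step : ∀ r, T.dist u r + T.dist r v = T.dist u v → T.dist u r = k + 1 →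
        ∃ n, T.Adj u n ∧ T.dist n r + 1 = T.dist u r ∧ T.dist n v + 1 = T.dist u v := by
      intro r hr hr'
      have hne : u ≠ r := by
        rintro rfl
        simp at hr'
      obtain ⟨n, hn, hnr⟩ := hT.exists_adj_dist_add_one hne
      refine ⟨n, hn, hnr, ?_⟩
      have h1 := hT.connected.dist_triangle (u := n) (v := r) (w := v)
      have := hT.dist_adj hn v
      omega
    obtain ⟨n, hn, hnp, hnv⟩ := step p hp hk
    obtain ⟨n', hn', hnq, hnv'⟩ := step q hq (h ▸ hk)
    obtain rfl := hT.adj_unique hn hn' hnv hnv'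
    exact ih (u := n) (by omega) (by omega) (by omega) (by omega)

theorem dist_le_of_between (hT : T.IsTree) {u v p q : V}
    (hp : T.dist u p + T.dist p v = T.dist u v) (hq : T.dist u q + T.dist q v = T.dist u v)
    (h : T.dist u p ≤ T.dist u q) : T.dist u p + T.dist p q = T.dist u q := by
  obtain ⟨r, hr, hrq⟩ := hT.exists_dist_eq h
  have h1 := hT.connected.dist_triangle (u := r) (v := q) (w := v)
  have h2 := hT.connected.dist_triangle (u := u) (v := r) (w := v)
  obtain rfl := hT.eq_of_dist_eq hp (q := r) (by omega) hr.symm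
  exact hrq

theorem dist_add_of_adj (hT : T.IsTree) {u n v w : V} (hn : T.Adj u n)
    (hv : T.dist n v + 1 = T.dist u v) (hw : T.dist n w = T.dist u w + 1) :
    T.dist v w = T.dist u v + T.dist u w := by
  induction hk : T.dist n v generalizing u n with
  | zero =>
    obtain rfl := hT.connected.dist_eq_zero_iff.1 hk
    omega
  | succ k ih =>
    have hne : n ≠ v := by
      rintro rfl
      simp at hk
    obtain ⟨m, hm, hmv⟩ := hT.exists_adj_dist_add_one hne
    rcases hT.dist_adj hm w with h | h
    · obtain rfl := hT.adj_unique hm hn.symm h (by omega)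
      omega
    · have := ih hm hmv h (by omega)
      omega

theorem exists_median (hT : T.IsTree) (u v w : V) :
    ∃ m, T.dist u m + T.dist m v = T.dist u v ∧ T.dist u m + T.dist m w = T.dist u w ∧
      T.dist v m + T.dist m w = T.dist v w := by
  induction hk : T.dist u v generalizing u with
  | zero =>
    obtain rfl := hT.connected.dist_eq_zero_iff.1 hk
    exact ⟨u, by simp⟩
  | succ k ih =>
    have hne : u ≠ v := by
      rintro rfl
      simp at hk
    obtain ⟨n, hn, hnv⟩ := hT.exists_adj_dist_add_one hne
    rcases hT.dist_adj hn w with h | h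
    · obtain ⟨m, h1, h2, h3⟩ := ih n (by omega)
      have h4 := hT.connected.dist_triangle (u := u) (v := n) (w := m)
      have h5 := dist_eq_one_iff_adj.2 hn
      have h6 := hT.connected.dist_triangle (u := u) (v := m) (w := w)
      have h7 := hT.connected.dist_triangle (u := u) (v := m) (w := v)
      exact ⟨m, by omega, by omega, h3⟩
    · have := hT.dist_add_of_adj hn hnv h
      refine ⟨u, by simp [hk], by simp, ?_⟩
      rw [T.dist_comm (u := v) (v := u)]
      omega

theorem between_or_between (hT : T.IsTree) {u v n : V}
    (hn : T.dist u n + T.dist n v = T.dist u v) (w : V) :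
    T.dist u n + T.dist n w = T.dist u w ∨ T.dist v n + T.dist n w = T.dist v w := by
  obtain ⟨m, h1, h2, h3⟩ := hT.exists_median u v w
  have e1 := T.dist_comm (u := n) (v := v)
  have e2 := T.dist_comm (u := m) (v := v)
  have e3 := T.dist_comm (u := u) (v := v)
  have e4 := T.dist_comm (u := n) (v := u)
  have e5 := T.dist_comm (u := m) (v := u)
  have h4 := hT.connected.dist_triangle (u := n) (v := m) (w := w)
  have h5 := hT.connected.dist_triangle (u := u) (v := n) (w := w)
  have h6 := hT.connected.dist_triangle (u := v) (v := n) (w := w)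
  rcases le_total (T.dist u n) (T.dist u m) with h | h
  · left
    have := hT.dist_le_of_between hn h1 h
    omega
  · right
    have := hT.dist_le_of_between (u := v) (v := u) (p := n) (q := m)
      (by omega) (by omega) (by omega)
    omega

theorem even_dist (hT : T.IsTree) (u v w : V) :
    Even (T.dist u v + T.dist u w + T.dist v w) := by
  obtain ⟨m, h1, h2, h3⟩ := hT.exists_median u v w
  have e2 := T.dist_comm (u := m) (v := v)
  exact ⟨T.dist u m + T.dist m v + T.dist m w, by omega⟩

theorem eq_of_le (hT : T.IsTree) {S : SimpleGraph V} (hS : S.IsTree) (h : S ≤ T) : S = T :=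
  le_antisymm h ((isTree_iff_minimal_connected.1 hT).2 hS.connected h)

end SimpleGraph.IsTree

namespace TreeAction

open MulAction Filter

variable {G : Type*} [Group G] {V : Type*} [MulAction G V] {T : SimpleGraph V}

theorem dist_smul (hT : T.IsTree) (hG : ∀ (g : G) ⦃u v : V⦄, T.Adj u v → T.Adj (g • u) (g • v))
    (g : G) (u v : V) : T.dist (g • u) (g • v) = T.dist u v := by
  have key : ∀ (k : G) (a b : V), T.dist (k • a) (k • b) ≤ T.dist a b := by
    intro k a b
    obtain ⟨p, hp⟩ := hT.connected.exists_walk_length_eq_dist a b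
    let φ : T →g T := ⟨(k • ·), fun h => hG k h⟩
    rw [← hp, ← p.length_map φ]
    exact SimpleGraph.dist_le (p.map φ)
  apply le_antisymm (key g u v)
  simpa using key g⁻¹ (g • u) (g • v)

theorem smul_eq_of_between (hT : T.IsTree)
    (hG : ∀ (g : G) ⦃u v : V⦄, T.Adj u v → T.Adj (g • u) (g • v))
    {g : G} {u p v : V} (hu : g • u = u) (hv : g • v = v)
    (hp : T.dist u p + T.dist p v = T.dist u v) : g • p = p := by
  have h1 := dist_smul hT hG g u p
  have h2 := dist_smul hT hG g p v
  rw [hu] at h1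
  rw [hv] at h2
  exact hT.eq_of_dist_eq (u := u) (v := v) (by omega) hp h1

/-- If `g` fixes `u` but moves `n`, `h` fixes `v` but moves `m`, and the parts of the segment
`[u, v]` moved by `g` and by `h` cover it, then `g * h` is hyperbolic. -/
theorem mul_smul_ne (hT : T.IsTree)
    (hG : ∀ (g : G) ⦃u v : V⦄, T.Adj u v → T.Adj (g • u) (g • v))
    {g h : G} {u v n m : V} (hu : g • u = u) (hv : h • v = v) (hgn : g • n ≠ n)
    (hhm : h • m ≠ m) (hn : T.dist u n + T.dist n v = T.dist u v)
    (hm : T.dist u m + T.dist m v = T.dist u v) (hnm : T.dist u n ≤ T.dist u m + 1) (p : V) :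
    (g * h) • p ≠ p := by
  intro hp
  rw [mul_smul] at hp
  set q := h • p with hq
  have e1 : T.dist v q = T.dist v p := by
    rw [← dist_smul hT hG h v p, hv]
  have e2 : T.dist u p = T.dist u q := by
    rw [← dist_smul hT hG g u q, hu, hp]
  have k1 : ¬ (T.dist u n + T.dist n q = T.dist u q ∧ T.dist u n + T.dist n p = T.dist u p) := by
    rintro ⟨a, b⟩
    have h1 := dist_smul hT hG g u n
    have h2 := dist_smul hT hG g n q
    rw [hu] at h1
    rw [hp] at h2
    exact hgn (hT.eq_of_dist_eq (u := u) (v := p) (by omega) b h1)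
  have k2 : ¬ (T.dist v m + T.dist m p = T.dist v p ∧ T.dist v m + T.dist m q = T.dist v q) := by
    rintro ⟨a, b⟩
    have h1 := dist_smul hT hG h v m
    have h2 := dist_smul hT hG h m p
    rw [hv] at h1
    rw [← hq] at h2
    exact hhm (hT.eq_of_dist_eq (u := v) (v := q) (by omega) b h1)
  have n1 := hT.between_or_between hn p
  have n2 := hT.between_or_between hn q
  have m1 := hT.between_or_between hm p
  have m2 := hT.between_or_between hm q
  have tri : ∀ a b c, T.dist a c ≤ T.dist a b + T.dist b c :=
    fun a b c => hT.connected.dist_triangle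
  have t1 := tri u n p
  have t2 := tri u n q
  have t3 := tri v n p
  have t4 := tri v n q
  have t5 := tri u m p
  have t6 := tri u m q
  have t7 := tri v m p
  have t8 := tri v m q
  have c1 := T.dist_comm (u := n) (v := v)
  have c2 := T.dist_comm (u := m) (v := v)
  obtain ⟨x, hx⟩ := hT.even_dist u v p
  omega

theorem eq_of_stabilizer_le (hT : T.IsTree)
    (hG : ∀ (g : G) ⦃u v : V⦄, T.Adj u v → T.Adj (g • u) (g • v))
    (hp : ∀ ⦃u v : V⦄, T.Adj u v → ¬ stabilizer G u ≤ stabilizer G v) {u v : V}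
    (h : stabilizer G u ≤ stabilizer G v) : u = v := by
  by_contra hne
  obtain ⟨n, hn, hnv⟩ := hT.exists_adj_dist_add_one hne
  refine hp hn fun g hg => smul_eq_of_between hT hG hg (h hg) ?_
  have := SimpleGraph.dist_eq_one_iff_adj.2 hn
  omega

theorem eq_of_forall_mul_elliptic (hT : T.IsTree)
    (hG : ∀ (g : G) ⦃u v : V⦄, T.Adj u v → T.Adj (g • u) (g • v))
    (hp : ∀ ⦃u v : V⦄, T.Adj u v → ¬ stabilizer G u ≤ stabilizer G v) {u v : V}
    (h : ∀ g ∈ stabilizer G u, ∀ k ∈ stabilizer G v, ∃ p : V, (g * k) • p = p) : u = v := by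
  by_contra hne
  obtain ⟨n, hn, hnv⟩ := hT.exists_adj_dist_add_one hne
  obtain ⟨m, hm, hmu⟩ := hT.exists_adj_dist_add_one (Ne.symm hne)
  obtain ⟨g, hg, hgn⟩ := SetLike.not_le_iff_exists.1 (hp hn)
  obtain ⟨k, hk, hkm⟩ := SetLike.not_le_iff_exists.1 (hp hm)
  obtain ⟨p, hgk⟩ := h g hg k hk
  have h1 := SimpleGraph.dist_eq_one_iff_adj.2 hn
  have h2 := SimpleGraph.dist_eq_one_iff_adj.2 hm
  have c1 := T.dist_comm (u := u) (v := v)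
  have c2 := T.dist_comm (u := u) (v := m)
  have c3 := T.dist_comm (u := v) (v := m)
  exact mul_smul_ne hT hG hg hk hgn hkm (by omega) (by omega) (by omega) p hgk

/-- A vertex `n` is the next vertex after `u` towards the fixed points of all the elements of `H`
that move `u`. -/
def IsStep (T : SimpleGraph V) (H : Subgroup G) (u n : V) : Prop :=
  T.Adj u n ∧ ∀ h ∈ H, h • u ≠ u → ∀ p : V, h • p = p → T.dist n p + 1 = T.dist u p

theorem exists_isStep (hT : T.IsTree)
    (hG : ∀ (g : G) ⦃u v : V⦄, T.Adj u v → T.Adj (g • u) (g • v)) {H : Subgroup G}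
    (hH : ∀ h ∈ H, ∃ p : V, h • p = p) {u : V} (hu : ∃ h ∈ H, h • u ≠ u) :
    ∃ n, IsStep T H u n := by
  obtain ⟨g, hg, hgu⟩ := hu
  obtain ⟨q, hq⟩ := hH g hg
  have hne : u ≠ q := by
    rintro rfl
    exact hgu hq
  obtain ⟨n, hn, hnq⟩ := hT.exists_adj_dist_add_one hne
  refine ⟨n, hn, fun h hh hhu p hp => (hT.dist_adj hn p).resolve_right fun hnp => ?_⟩
  have := hT.dist_add_of_adj hn hnq hnp
  have c := T.dist_comm (u := u) (v := q)
  obtain ⟨r, hr⟩ := hH (g * h) (H.mul_mem hg hh)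
  exact mul_smul_ne hT hG hq hp hgu hhu (by omega) (by omega) (by omega) r hr

theorem IsStep.unique (hT : T.IsTree) {H : Subgroup G} (hH : ∀ h ∈ H, ∃ p : V, h • p = p)
    {u n n' : V} (hu : ∃ h ∈ H, h • u ≠ u) (hn : IsStep T H u n) (hn' : IsStep T H u n') :
    n = n' := by
  obtain ⟨g, hg, hgu⟩ := hu
  obtain ⟨q, hq⟩ := hH g hg
  exact hT.adj_unique hn.1 hn'.1 (hn.2 g hg hgu q hq) (hn'.2 g hg hgu q hq)

theorem IsStep.mono {H K : Subgroup G} (hKH : K ≤ H) {u n : V} (hn : IsStep T H u n) :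
    IsStep T K u n :=
  ⟨hn.1, fun h hh => hn.2 h (hKH hh)⟩

theorem IsStep.smul (hT : T.IsTree)
    (hG : ∀ (g : G) ⦃u v : V⦄, T.Adj u v → T.Adj (g • u) (g • v)) {H K : Subgroup G} {g : G}
    (hK : ∀ k ∈ K, g⁻¹ * k * g ∈ H) {u n : V} (hn : IsStep T H u n) :
    IsStep T K (g • u) (g • n) := by
  refine ⟨hG g hn.1, fun k hk hku p hp => ?_⟩
  have h1 := hn.2 _ (hK k hk) (fun h => hku ?_) (g⁻¹ • p) ?_
  · rwa [← dist_smul hT hG g n, ← dist_smul hT hG g u, smul_inv_smul] at h1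
  · rw [mul_smul, mul_smul, inv_smul_eq_iff] at h
    exact h
  · simp [mul_smul, hp]

/-- A group of elliptic automorphisms without a common fixed vertex fixes an end: every ray towards
this end is eventually fixed by each element of the group. -/
theorem exists_ray (hT : T.IsTree)
    (hG : ∀ (g : G) ⦃u v : V⦄, T.Adj u v → T.Adj (g • u) (g • v)) {H : Subgroup G}
    (hH : ∀ h ∈ H, ∃ p : V, h • p = p) (hfix : ∀ u : V, ∃ h ∈ H, h • u ≠ u) (u : V) :
    ∃ x : ℕ → V, x 0 = u ∧ (∀ i, T.Adj (x i) (x (i + 1))) ∧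
      (∀ h ∈ H, ∀ i j, i ≤ j → h • x i = x i → h • x j = x j) ∧
      (∀ h ∈ H, ∀ᶠ i in atTop, h • x i = x i) ∧
      ∀ h ∈ H, ∀ i j, h • x i = x j → i = j := by
  choose n hn using fun u => exists_isStep hT hG hH (hfix u)
  have hequiv : ∀ h ∈ H, ∀ v, n (h • v) = h • n v := fun h hh v =>
    (hn (h • v)).unique hT hH (hfix _) ((hn v).smul hT hG fun k hk =>
      H.mul_mem (H.mul_mem (H.inv_mem hh) hk) hh)
  have hfix_step : ∀ h ∈ H, ∀ v, h • v = v → h • n v = n v := fun h hh v hv => by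
    rw [← hequiv h hh, hv]
  have hback : ∀ v, n (n v) ≠ v := by
    intro v hv
    obtain ⟨h, hh, hhv⟩ := hfix (n v)
    obtain ⟨p, hp⟩ := hH h hh
    have h1 := (hn (n v)).2 h hh hhv p hp
    have h2 := (hn v).2 h hh (fun h' => hhv (hfix_step h hh v h')) p hp
    rw [hv] at h1
    omega
  let x : ℕ → V := fun i => n^[i] u
  have hx : ∀ i, x (i + 1) = n (x i) := fun i => Function.iterate_succ_apply' n i u
  have hmono : ∀ h ∈ H, ∀ i j, i ≤ j → h • x i = x i → h • x j = x j := by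
    intro h hh i j hij hi
    induction j, hij using Nat.le_induction with
    | base => exact hi
    | succ j _ ih =>
      rw [hx]
      exact hfix_step h hh _ ih
  have hadj : ∀ i, T.Adj (x i) (x (i + 1)) := fun i => by
    rw [hx]
    exact (hn _).1
  have hev : ∀ h ∈ H, ∀ᶠ i in atTop, h • x i = x i := by
    intro h hh
    obtain ⟨p, hp⟩ := hH h hh
    have key : ∀ i, h • x i = x i ∨ T.dist (x i) p + i ≤ T.dist u p := by
      intro i
      induction i with
      | zero => right; simp [x]
      | succ i ih =>
        by_cases hi : h • x i = x i
        · left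
          exact hmono h hh i _ (by omega) hi
        · right
          have := (hn (x i)).2 h hh hi p hp
          rw [← hx] at this
          have := ih.resolve_left hi
          omega
    refine eventually_atTop.2 ⟨T.dist u p + 1, fun i hi => (key i).resolve_right ?_⟩
    omega
  have hdist : ∀ i k, T.dist (x (i + k)) (x i) = k ∧
      T.dist (x (i + k + 1)) (x i) = k + 1 := by
    intro i k
    induction k with
    | zero => simp [SimpleGraph.dist_eq_one_iff_adj, (hadj i).symm]
    | succ k ih =>
      refine ⟨ih.2, ?_⟩
      rcases hT.dist_adj (hadj (i + k + 1)) (x i) with h | h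
      · exfalso
        have := hT.adj_unique (hadj (i + k + 1)) (hadj (i + k)).symm h (by omega)
        rw [hx, hx] at this
        exact hback _ this
      · rw [← add_assoc, h, ih.2]
  refine ⟨x, rfl, hadj, hmono, hev, fun h hh i j hij => ?_⟩
  obtain ⟨N, hN⟩ := eventually_atTop.1 (hev h hh)
  have h1 := (hdist i (N + j)).1
  have h2 := (hdist j (N + i)).1
  rw [← dist_smul hT hG h, hij, hN _ (by omega), show i + (N + j) = j + (N + i) by omega, h2] at h1
  omega

end TreeAction

namespace TreeAction

open MulAction Filter

variable {G : Type*} [Group G] {V W : Type*} [MulAction G V] [MulAction G W]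
  {T : SimpleGraph V} {S : SimpleGraph W}

theorem exists_fixed_of_equivariant (hT : T.IsTree)
    (hG : ∀ (g : G) ⦃u v : V⦄, T.Adj u v → T.Adj (g • u) (g • v)) (hS : S.IsTree)
    (hGS : ∀ (g : G) ⦃u v : W⦄, S.Adj u v → S.Adj (g • u) (g • v))
    (hp : ∀ ⦃u v : W⦄, S.Adj u v → ¬ stabilizer G u ≤ stabilizer G v)
    {F : Set (V × V)} (hF : F.Finite)
    (hFT : ∀ u v, T.Adj u v → ∃ e ∈ F, ∃ g : G, g • e = (u, v))
    {f : V → W} (hf : ∀ (g : G) v, f (g • v) = g • f v)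
    (hfs : ∀ v, stabilizer G (f v) ≤ stabilizer G v) {w : W}
    (hw : ∀ g ∈ stabilizer G w, ∃ v : V, g • v = v) :
    ∃ v : V, stabilizer G w ≤ stabilizer G v := by
  by_contra! hfix
  have hfix' : ∀ v : V, ∃ h ∈ stabilizer G w, h • v ≠ v := fun v =>
    SetLike.not_le_iff_exists.1 (hfix v)
  have : Nonempty V := hT.connected.nonempty
  obtain ⟨x, -, hadj, -, hev, hinj⟩ := exists_ray hT hG hw hfix' (Classical.arbitrary V)
  have hne : ∀ i, w ≠ f (x i) := by
    intro i hi
    apply hfix (x i)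
    rw [hi]
    exact hfs _
  choose d hd hdx using fun i => hS.exists_adj_dist_add_one (hne i)
  have hfin : {i | d i ≠ d (i + 1)}.Finite := by
    by_contra hinf
    choose! e he g hg using fun i => hFT _ _ (hadj i)
    have hbtw : ∀ i, d i ≠ d (i + 1) →
        S.dist (f (x i)) w + S.dist w (f (x (i + 1))) =
          S.dist (f (x i)) (f (x (i + 1))) := by
      intro i hi
      have h2 := (hS.dist_adj (hd i) (f (x (i + 1)))).resolve_left fun h =>
        hi (hS.adj_unique (hd i) (hd (i + 1)) h (hdx (i + 1)))
      rw [hS.dist_add_of_adj (hd i) (hdx i) h2, S.dist_comm (u := f (x i))]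
    obtain ⟨M, hM⟩ := (hF.image fun p => S.dist (f p.1) (f p.2)).bddAbove
    have hbound : ∀ i, S.dist (f (x i)) (f (x (i + 1))) ≤ M := by
      intro i
      have h1 := congrArg Prod.fst (hg i)
      have h2 := congrArg Prod.snd (hg i)
      simp only [Prod.smul_fst, Prod.smul_snd] at h1 h2
      rw [← h1, ← h2, hf, hf, dist_smul hS hGS]
      exact hM ⟨_, he i, rfl⟩
    obtain ⟨i, hi, j, hj, hij, heq⟩ := Set.Infinite.exists_ne_map_eq_of_mapsTo
      (f := fun i => (e i, S.dist (f (x i)) w)) (t := F ×ˢ Set.Iic M) hinf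
      (fun i hi => ⟨he i, by
        have := hbtw i hi
        have := hbound i
        simp only [Set.mem_Iic]
        omega⟩) (hF.prod (Set.finite_Iic M))
    obtain ⟨hee, hdd⟩ := Prod.mk.injEq .. ▸ heq
    have hk : (g j * (g i)⁻¹) • (x i, x (i + 1)) = (x j, x (j + 1)) := by
      rw [← hg i, ← hg j, hee, mul_smul, inv_smul_smul]
    have hk1 : (g j * (g i)⁻¹) • x i = x j := congrArg Prod.fst hk
    have hk2 : (g j * (g i)⁻¹) • x (i + 1) = x (j + 1) := congrArg Prod.snd hk
    generalize g j * (g i)⁻¹ = k at hk1 hk2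
    have h1 := dist_smul hS hGS k (f (x i)) w
    have h2 := dist_smul hS hGS k w (f (x (i + 1)))
    have h3 := dist_smul hS hGS k (f (x i)) (f (x (i + 1)))
    rw [← hf, hk1] at h1
    rw [← hf, hk2] at h2
    rw [← hf, ← hf, hk1, hk2] at h3
    have h4 := hbtw i hi
    have h5 := hbtw j hj
    exact hij (hinj k (hS.eq_of_dist_eq (by omega) h5 (by omega)) i j hk1)
  obtain ⟨N, hN⟩ := hfin.bddAbove
  have hconst : ∀ i, N + 1 ≤ i → d i = d (N + 1) := by
    intro i hi
    induction i, hi using Nat.le_induction with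
    | base => rfl
    | succ i hi ih =>
      rw [← ih]
      by_contra h
      have := hN (a := i) (Ne.symm h)
      omega
  refine hp (hd (N + 1)) fun h hh => ?_
  obtain ⟨i, hi, hi'⟩ := ((hev h hh).and (eventually_ge_atTop (N + 1))).exists
  rw [← hconst i hi']
  refine smul_eq_of_between hS hGS hh (v := f (x i)) (by rw [← hf, hi]) ?_
  have := SimpleGraph.dist_eq_one_iff_adj.2 (hd i)
  have := hdx i
  omega

theorem exists_smul_ne_of_adj (hG : ∀ (g : G) ⦃u v : V⦄, T.Adj u v → T.Adj (g • u) (g • v))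
    (hS : S.IsTree) (hGS : ∀ (g : G) ⦃u v : W⦄, S.Adj u v → S.Adj (g • u) (g • v)) {u v : V}
    (hfin : (T.neighborSet u).Finite) (huv : T.Adj u v)
    (hell : ∀ g ∈ stabilizer G u, ∃ w : W, g • w = w)
    (hu : ∀ w : W, ∃ g ∈ stabilizer G u, g • w ≠ w) (w : W) :
    ∃ g ∈ stabilizer G u ⊓ stabilizer G v, g • w ≠ w := by
  by_contra! hw
  obtain ⟨x, rfl, -, hmono, hev, -⟩ := exists_ray hS hGS hell hu w
  have key : ∀ z, ∀ᶠ i in atTop, ∀ h ∈ stabilizer G u, h • v = z → h • x i = x i := by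
    intro z
    by_cases hz : ∃ k ∈ stabilizer G u, k • v = z
    · obtain ⟨k, hk, rfl⟩ := hz
      filter_upwards [hev k hk] with i hi h hh hhv
      have hmem : k⁻¹ * h ∈ stabilizer G u := mul_mem (inv_mem hk) hh
      have h0 := hw (k⁻¹ * h) ⟨hmem, by
        change (k⁻¹ * h) • v = v
        rw [mul_smul, hhv, inv_smul_smul]⟩
      have h1 := hmono _ hmem 0 i (Nat.zero_le _) h0
      rw [mul_smul, inv_smul_eq_iff] at h1
      rw [h1, hi]
    · push Not at hz
      exact Eventually.of_forall fun i h hh hhv => absurd hhv (hz h hh)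
  obtain ⟨i, hi⟩ := ((eventually_all_finite hfin).2 fun z _ => key z).exists
  obtain ⟨h, hh, hne⟩ := hu (x i)
  refine hne (hi (h • v) ?_ h hh rfl)
  have := hG h huv
  rwa [mem_stabilizer_iff.1 hh] at this

theorem exists_fixed_of_locallyFinite (hT : T.IsTree)
    (hG : ∀ (g : G) ⦃u v : V⦄, T.Adj u v → T.Adj (g • u) (g • v)) (hS : S.IsTree)
    (hGS : ∀ (g : G) ⦃u v : W⦄, S.Adj u v → S.Adj (g • u) (g • v))
    (hp : ∀ ⦃u v : W⦄, S.Adj u v → ¬ stabilizer G u ≤ stabilizer G v)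
    (hfin : ∀ u, (T.neighborSet u).Finite)
    (hell : ∀ u : V, ∀ g ∈ stabilizer G u, ∃ w : W, g • w = w) (u : V) :
    ∃ w : W, stabilizer G u ≤ stabilizer G w := by
  by_contra! hfix
  have hfix' : ∀ w : W, ∃ h ∈ stabilizer G u, h • w ≠ w := fun v =>
    SetLike.not_le_iff_exists.1 (hfix v)
  have key : ∀ v : V, (∀ w : W, ∃ h ∈ stabilizer G v, h • w ≠ w) ∧
      ∀ w n, IsStep S (stabilizer G u) w n → IsStep S (stabilizer G v) w n := by
    intro v
    obtain ⟨p⟩ := hT.connected.preconnected v u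
    induction p with
    | nil => exact ⟨hfix', fun _ _ => id⟩
    | @cons v v' _ hadj _ ih =>
      obtain ⟨ih1, ih2⟩ := ih hfix hfix'
      have hne := exists_smul_ne_of_adj hG hS hGS (hfin v') hadj.symm (hell v') ih1
      have hne' : ∀ w : W, ∃ h ∈ stabilizer G v, h • w ≠ w := fun w =>
        let ⟨h, hh, hw⟩ := hne w
        ⟨h, hh.2, hw⟩
      refine ⟨hne', fun w n hn => ?_⟩
      obtain ⟨m, hm⟩ := exists_isStep hS hGS (hell v) (hne' w)
      have hn' : IsStep S (stabilizer G v' ⊓ stabilizer G v) w n := (ih2 w n hn).mono inf_le_left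
      have hell' : ∀ h ∈ stabilizer G v' ⊓ stabilizer G v, ∃ w : W, h • w = w :=
        fun h hh => hell v h hh.2
      rwa [hn'.unique hS hell' (hne w) (hm.mono inf_le_right)]
  obtain ⟨w⟩ := hS.connected.nonempty
  obtain ⟨n, hn⟩ := exists_isStep hS hGS (hell u) (hfix' w)
  refine hp hn.1 fun g hg => ?_
  obtain ⟨h1, h2⟩ := key (g • u)
  have h3 : IsStep S (stabilizer G (g • u)) (g • w) (g • n) := hn.smul hS hGS fun k hk => by
    rw [mem_stabilizer_iff] at hk ⊢
    rw [mul_smul, mul_smul, hk, inv_smul_smul]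
  rw [mem_stabilizer_iff.1 hg] at h3
  exact (h3.unique hS (hell _) (h1 w) (h2 w n hn))

theorem stabilizer_le_of_stabilizer_le (hT : T.IsTree)
    (hG : ∀ (g : G) ⦃u v : V⦄, T.Adj u v → T.Adj (g • u) (g • v))
    (hp : ∀ ⦃u v : V⦄, T.Adj u v → ¬ stabilizer G u ≤ stabilizer G v) {v : V} {w : W}
    (hell : ∀ g ∈ stabilizer G w, ∃ v : V, g • v = v)
    (h : stabilizer G v ≤ stabilizer G w) : stabilizer G w ≤ stabilizer G v := by
  intro g hg
  refine (eq_of_forall_mul_elliptic hT hG hp fun a ha b hb => hell _ (mul_mem ?_ (h hb)))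
  have hmem : g⁻¹ * a * g ∈ stabilizer G v := by
    rw [mem_stabilizer_iff] at ha ⊢
    rw [mul_smul, mul_smul, ha, inv_smul_smul]
  have := mul_mem (mul_mem hg (h hmem)) (inv_mem hg)
  simpa [mul_assoc] using this

/-- If each vertex stabilizer of one proper tree fixes a vertex of the other, then the converse
holds as well, provided all these stabilizers consist of elliptic elements. -/
theorem exists_fixed_of_forall_exists_fixed (hT : T.IsTree)
    (hG : ∀ (g : G) ⦃u v : V⦄, T.Adj u v → T.Adj (g • u) (g • v))
    (hpT : ∀ ⦃u v : V⦄, T.Adj u v → ¬ stabilizer G u ≤ stabilizer G v) (hS : S.IsTree)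
    (hGS : ∀ (g : G) ⦃u v : W⦄, S.Adj u v → S.Adj (g • u) (g • v))
    (hp : ∀ ⦃u v : W⦄, S.Adj u v → ¬ stabilizer G u ≤ stabilizer G v)
    {F : Set (V × V)} (hF : F.Finite)
    (hFT : ∀ u v, T.Adj u v → ∃ e ∈ F, ∃ g : G, g • e = (u, v))
    (hell : ∀ w : W, ∀ g ∈ stabilizer G w, ∃ v : V, g • v = v)
    (h : ∀ v : V, ∃ w : W, stabilizer G v ≤ stabilizer G w) (w : W) :
    ∃ v : V, stabilizer G w ≤ stabilizer G v := by
  choose f hf using h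
  have hf' : ∀ v, stabilizer G (f v) ≤ stabilizer G v := fun v =>
    stabilizer_le_of_stabilizer_le hT hG hpT (hell (f v)) (hf v)
  refine exists_fixed_of_equivariant hT hG hS hGS hp hF hFT (f := f) (fun g v => ?_) hf' (hell w)
  refine eq_of_stabilizer_le hS hGS hp ((hf' _).trans ?_)
  rw [stabilizer_smul_eq_stabilizer_map_conj, stabilizer_smul_eq_stabilizer_map_conj]
  exact Subgroup.map_mono (hf v)

end TreeAction

namespace TreeAction

open MulAction

variable {G : Type*} [Group G] {V : Type*} [MulAction G V] {S T : SimpleGraph V}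

theorem mem_stabilizer_smul {g h : G} {u : V} :
    h ∈ stabilizer G (g • u) ↔ g⁻¹ * h * g ∈ stabilizer G u := by
  rw [mem_stabilizer_iff, mem_stabilizer_iff, mul_smul, mul_smul, inv_smul_eq_iff]

theorem stabilizer_inf_le_smul {u v w : V} (h : stabilizer G u ⊓ stabilizer G v ≤ stabilizer G w)
    (g : G) : stabilizer G (g • u) ⊓ stabilizer G (g • v) ≤ stabilizer G (g • w) :=
  fun _ hk => mem_stabilizer_smul.2 (h ⟨mem_stabilizer_smul.1 hk.1, mem_stabilizer_smul.1 hk.2⟩)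

variable (G S) in
/-- The edge from `a` to `b` lies on the `S`-geodesic from `u` to `v`, and `b` is the first vertex
of that geodesic whose stabilizer meets the stabilizer of `u` within the stabilizer of `v`. -/
structure IsCrossing (u v a b : V) : Prop where
  adj : S.Adj a b
  dist_add : S.dist u a + 1 + S.dist b v = S.dist u v
  left : stabilizer G u ⊓ stabilizer G b ≤ stabilizer G v
  right : stabilizer G v ⊓ stabilizer G a ≤ stabilizer G u
  le_dist : ∀ c, S.dist u c + S.dist c v = S.dist u v →
    stabilizer G u ⊓ stabilizer G c ≤ stabilizer G v → S.dist u a + 1 ≤ S.dist u c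

theorem dist_eq_of_dist_add (hS : S.IsTree) {u v a b : V} (hab : S.Adj a b)
    (h : S.dist u a + 1 + S.dist b v = S.dist u v) :
    S.dist u b = S.dist u a + 1 ∧ S.dist a v = S.dist b v + 1 := by
  have h1 := hS.connected.dist_triangle (u := u) (v := a) (w := b)
  have h2 := hS.connected.dist_triangle (u := u) (v := b) (w := v)
  have h3 := hS.connected.dist_triangle (u := u) (v := a) (w := v)
  have h4 := hS.connected.dist_triangle (u := a) (v := b) (w := v)
  have h5 := SimpleGraph.dist_eq_one_iff_adj.2 hab
  omega

theorem exists_isCrossing (hT : T.IsTree)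
    (hG : ∀ (g : G) ⦃u v : V⦄, T.Adj u v → T.Adj (g • u) (g • v))
    (hp : ∀ ⦃u v : V⦄, T.Adj u v → ¬ stabilizer G u ≤ stabilizer G v) (hS : S.IsTree) {u v : V}
    (huv : T.Adj u v) : ∃ a b, IsCrossing G S u v a b := by
  classical
  have hex : ∃ k c, S.dist u c = k ∧ S.dist u c + S.dist c v = S.dist u v ∧
      stabilizer G u ⊓ stabilizer G c ≤ stabilizer G v :=
    ⟨_, v, rfl, by simp, inf_le_right⟩
  obtain ⟨b, hbk, hb, hbs⟩ := Nat.find_spec hex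
  have hmin : ∀ c, S.dist u c + S.dist c v = S.dist u v →
      stabilizer G u ⊓ stabilizer G c ≤ stabilizer G v → S.dist u b ≤ S.dist u c :=
    fun c hc hcs => hbk ▸ Nat.find_min' hex ⟨c, rfl, hc, hcs⟩
  have hne : b ≠ u := by
    rintro rfl
    exact hp huv (by simpa using hbs)
  obtain ⟨a, ha, hau⟩ := hS.exists_adj_dist_add_one hne
  rw [S.dist_comm, S.dist_comm (u := b)] at hau
  have h1 := hS.connected.dist_triangle (u := u) (v := a) (w := v)
  have h2 := hS.connected.dist_triangle (u := a) (v := b) (w := v)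
  have h3 := SimpleGraph.dist_eq_one_iff_adj.2 ha.symm
  refine ⟨a, b, ha.symm, by omega, hbs, ?_, fun c hc hcs => hau ▸ hmin c hc hcs⟩
  intro q hq
  by_contra hqu
  have hnot : ¬ stabilizer G u ⊓ stabilizer G a ≤ stabilizer G v := fun h => by
    have := hmin a (by omega) h
    omega
  obtain ⟨p, hpa, hpv⟩ := SetLike.not_le_iff_exists.1 hnot
  refine mul_smul_ne hT hG (u := u) (v := v) (n := v) (m := u) hpa.1 hq.1 hpv hqu (by simp)
    (by simp) (by simp [SimpleGraph.dist_eq_one_iff_adj.2 huv]) a ?_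
  rw [mul_smul, mem_stabilizer_iff.1 hq.2, mem_stabilizer_iff.1 hpa.2]

theorem IsCrossing.unique (hS : S.IsTree) {u v a b a' b' : V} (h : IsCrossing G S u v a b)
    (h' : IsCrossing G S u v a' b') : a = a' ∧ b = b' := by
  have h1 := dist_eq_of_dist_add hS h.adj h.dist_add
  have h2 := dist_eq_of_dist_add hS h'.adj h'.dist_add
  have h3 := h.dist_add
  have h4 := h'.dist_add
  have h5 := h.le_dist b' (by omega) h'.left
  have h6 := h'.le_dist b (by omega) h.left
  exact ⟨hS.eq_of_dist_eq (u := u) (v := v) (by omega) (by omega) (by omega),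
    hS.eq_of_dist_eq (u := u) (v := v) (by omega) (by omega) (by omega)⟩

theorem IsCrossing.smul (hS : S.IsTree)
    (hGS : ∀ (g : G) ⦃u v : V⦄, S.Adj u v → S.Adj (g • u) (g • v)) {u v a b : V}
    (h : IsCrossing G S u v a b) (g : G) : IsCrossing G S (g • u) (g • v) (g • a) (g • b) where
  adj := hGS g h.adj
  dist_add := by simpa only [dist_smul hS hGS] using h.dist_add
  left := stabilizer_inf_le_smul h.left g
  right := stabilizer_inf_le_smul h.right g
  le_dist c hc hcs := by
    obtain ⟨c, rfl⟩ : ∃ d, g • d = c := ⟨g⁻¹ • c, smul_inv_smul g c⟩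
    simp only [dist_smul hS hGS] at hc ⊢
    refine h.le_dist c hc ?_
    simpa using stabilizer_inf_le_smul hcs g⁻¹

variable (G) in
/-- A `G`-invariant orientation of the pairs of vertices that are not inverted by `G`. -/
def IsPositive (u v : V) : Prop :=
  WellOrderingRel (Quotient.mk (orbitRel G (V × V)) (u, v)) (Quotient.mk _ (v, u))

theorem isPositive_smul (g : G) (u v : V) : IsPositive G (g • u) (g • v) ↔ IsPositive G u v := by
  have key : ∀ p : V × V, Quotient.mk (orbitRel G (V × V)) (g • p) = Quotient.mk _ p :=
    fun p => Quotient.sound ⟨g, rfl⟩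
  have h1 := key (u, v)
  have h2 := key (v, u)
  rw [Prod.smul_mk] at h1 h2
  rw [IsPositive, IsPositive, h1, h2]

theorem isPositive_comm {u v : V} (h : ∀ g : G, ¬ (g • u = v ∧ g • v = u)) :
    IsPositive G v u ↔ ¬ IsPositive G u v := by
  refine ⟨fun h1 h2 => asymm_of WellOrderingRel h1 h2, fun h1 => ?_⟩
  refine (trichotomous_of WellOrderingRel (Quotient.mk (orbitRel G (V × V)) (u, v))
    (Quotient.mk _ (v, u))).elim (fun h2 => absurd h2 h1) fun h2 => h2.resolve_left fun h3 => ?_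
  obtain ⟨g, hg⟩ := Quotient.exact h3
  exact h g ⟨congrArg Prod.snd hg, congrArg Prod.fst hg⟩

variable (G S) in
/-- The symmetrized version of `IsCrossing`. -/
def IsMarked (u v a b : V) : Prop :=
  IsPositive G u v ∧ IsCrossing G S u v a b ∨ ¬ IsPositive G u v ∧ IsCrossing G S v u b a

namespace IsMarked

variable {u v a b a' b' : V}

theorem adj (h : IsMarked G S u v a b) : S.Adj a b :=
  h.elim (fun h => h.2.adj) fun h => h.2.adj.symm

theorem dist_add (h : IsMarked G S u v a b) : S.dist u a + 1 + S.dist b v = S.dist u v := by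
  refine h.elim (fun h => h.2.dist_add) fun h => ?_
  rw [S.dist_comm (u := u) (v := v), ← h.2.dist_add, S.dist_comm (u := u), S.dist_comm (u := b)]
  ring

theorem left (h : IsMarked G S u v a b) : stabilizer G u ⊓ stabilizer G b ≤ stabilizer G v :=
  h.elim (fun h => h.2.left) fun h => h.2.right

theorem symm (hinv : ∀ g : G, ¬ (g • u = v ∧ g • v = u)) (h : IsMarked G S u v a b) :
    IsMarked G S v u b a := by
  rw [IsMarked, isPositive_comm hinv, not_not]
  exact Or.symm h

theorem unique (hS : S.IsTree) (h : IsMarked G S u v a b) (h' : IsMarked G S u v a' b') :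
    a = a' ∧ b = b' := by
  rcases h with h | h <;> rcases h' with h' | h'
  · exact h.2.unique hS h'.2
  · exact absurd h.1 h'.1
  · exact absurd h'.1 h.1
  · exact (h.2.unique hS h'.2).symm

theorem smul (hS : S.IsTree)
    (hGS : ∀ (g : G) ⦃u v : V⦄, S.Adj u v → S.Adj (g • u) (g • v))
    (h : IsMarked G S u v a b) (g : G) : IsMarked G S (g • u) (g • v) (g • a) (g • b) := by
  rw [IsMarked, isPositive_smul]
  exact h.imp (fun h => ⟨h.1, h.2.smul hS hGS g⟩) fun h => ⟨h.1, h.2.smul hS hGS g⟩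

end IsMarked

theorem exists_isMarked (hT : T.IsTree)
    (hG : ∀ (g : G) ⦃u v : V⦄, T.Adj u v → T.Adj (g • u) (g • v))
    (hp : ∀ ⦃u v : V⦄, T.Adj u v → ¬ stabilizer G u ≤ stabilizer G v) (hS : S.IsTree) {u v : V}
    (huv : T.Adj u v) : ∃ a b, IsMarked G S u v a b := by
  by_cases h : IsPositive G u v
  · obtain ⟨a, b, hab⟩ := exists_isCrossing hT hG hp hS huv
    exact ⟨a, b, .inl ⟨h, hab⟩⟩
  · obtain ⟨a, b, hab⟩ := exists_isCrossing hT hG hp hS huv.symm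
    exact ⟨b, a, .inr ⟨h, hab⟩⟩

theorem IsMarked.eq_of_between (hS : S.IsTree)
    (hGS : ∀ (g : G) ⦃u v : V⦄, S.Adj u v → S.Adj (g • u) (g • v))
    (hslide : ∀ ⦃u v w : V⦄, T.Adj u v → T.Adj u w →
      stabilizer G u ⊓ stabilizer G v ≤ stabilizer G w → ∃ g : G, g • u = u ∧ g • v = w)
    {u v w a b a' b' : V} (huv : T.Adj u v) (huw : T.Adj u w) (h : IsMarked G S u v a b)
    (h' : IsMarked G S u w a' b') (hb : S.dist u b + S.dist b b' = S.dist u b') : v = w := by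
  have hbtw := dist_eq_of_dist_add hS h'.adj h'.dist_add
  have hadd := h'.dist_add
  have hle : stabilizer G u ⊓ stabilizer G w ≤ stabilizer G v := fun k hk => by
    have hkb' : k • b' = b' := smul_eq_of_between hS hGS hk.1 hk.2 (by omega)
    exact h.left ⟨hk.1, smul_eq_of_between hS hGS hk.1 hkb' hb⟩
  obtain ⟨g, hgu, hgw⟩ := hslide huw huv hle
  have hg := h'.smul hS hGS g
  rw [hgu, hgw] at hg
  obtain ⟨-, hbb⟩ := h.unique hS hg
  have hd := dist_smul hS hGS g u b'
  rw [hgu, ← hbb] at hd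
  have hbb' : b = b' := hS.connected.dist_eq_zero_iff.1 (by omega)
  rw [← hgw]
  exact h'.left ⟨hgu, mem_stabilizer_iff.2 (hbb.symm.trans hbb')⟩

theorem IsMarked.between (hT : T.IsTree)
    (hG : ∀ (g : G) ⦃u v : V⦄, T.Adj u v → T.Adj (g • u) (g • v))
    (hp : ∀ ⦃u v : V⦄, T.Adj u v → ¬ stabilizer G u ≤ stabilizer G v)
    (hinv : ∀ (g : G) ⦃u v : V⦄, T.Adj u v → ¬ (g • u = v ∧ g • v = u))
    (hslide : ∀ ⦃u v w : V⦄, T.Adj u v → T.Adj u w →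
      stabilizer G u ⊓ stabilizer G v ≤ stabilizer G w → ∃ g : G, g • u = u ∧ g • v = w)
    (hS : S.IsTree) (hGS : ∀ (g : G) ⦃u v : V⦄, S.Adj u v → S.Adj (g • u) (g • v))
    {u v a b s : V} (huv : T.Adj u v) (hs : T.dist v s + 1 = T.dist u s)
    (h : IsMarked G S u v a b) : S.dist u b + S.dist b s = S.dist u s := by
  have hadd := h.dist_add
  have hbtw := dist_eq_of_dist_add hS h.adj h.dist_add
  induction hk : T.dist v s generalizing u v a b with
  | zero =>
    obtain rfl := hT.connected.dist_eq_zero_iff.1 hk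
    omega
  | succ k ih =>
    have hne : v ≠ s := by
      rintro rfl
      simp at hk
    obtain ⟨w, hw, hws⟩ := hT.exists_adj_dist_add_one hne
    obtain ⟨a', b', h'⟩ := exists_isMarked hT hG hp hS hw
    have hadd' := h'.dist_add
    have hbtw' := dist_eq_of_dist_add hS h'.adj h'.dist_add
    have hb' := ih hw hws h' hadd' hbtw' (by omega)
    have hba := S.dist_comm (u := b) (v := u)
    have hsym := h.symm fun g => hinv g huv
    rcases hS.dist_adj h.adj s with h1 | h1
    · have h2 := hS.dist_add_of_adj h.adj.symm (v := u) (w := s)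
        (by rw [S.dist_comm, S.dist_comm (u := b)]; omega) h1.symm
      omega
    · exfalso
      have h2 := hS.dist_add_of_adj h.adj (v := v) (w := s) (by omega) h1
      have hav := S.dist_comm (u := a) (v := v)
      rcases le_total (S.dist v a) (S.dist v b') with h3 | h3
      · have := hsym.eq_of_between hS hGS hslide huv.symm hw h'
          (hS.dist_le_of_between (v := s) (by omega) hb' h3)
        subst this
        omega
      · have := h'.eq_of_between hS hGS hslide hw huv.symm hsym
          (hS.dist_le_of_between (v := s) hb' (by omega) h3)
        subst this
        omega

/-- Two invariant trees on the same vertex set coincide, if one of them is proper and strongly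
slide-free. -/
theorem eq_of_slideFree (hT : T.IsTree)
    (hG : ∀ (g : G) ⦃u v : V⦄, T.Adj u v → T.Adj (g • u) (g • v))
    (hp : ∀ ⦃u v : V⦄, T.Adj u v → ¬ stabilizer G u ≤ stabilizer G v)
    (hinv : ∀ (g : G) ⦃u v : V⦄, T.Adj u v → ¬ (g • u = v ∧ g • v = u))
    (hslide : ∀ ⦃u v w : V⦄, T.Adj u v → T.Adj u w →
      stabilizer G u ⊓ stabilizer G v ≤ stabilizer G w → ∃ g : G, g • u = u ∧ g • v = w)
    (hS : S.IsTree) (hGS : ∀ (g : G) ⦃u v : V⦄, S.Adj u v → S.Adj (g • u) (g • v)) : T = S := by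
  have key : ∀ ⦃u v a b : V⦄, T.Adj u v → IsMarked G S u v a b → u = a := by
    intro u v a b huv h
    by_contra hne
    have hadd := h.dist_add
    have hbtw := dist_eq_of_dist_add hS h.adj h.dist_add
    have hab := SimpleGraph.dist_eq_one_iff_adj.2 h.adj
    have hba := S.dist_comm (u := a) (v := b)
    obtain ⟨w, hw, hwa⟩ := hT.exists_adj_dist_add_one hne
    obtain ⟨a', b', h'⟩ := exists_isMarked hT hG hp hS hw
    have hb' := h'.between hT hG hp hinv hslide hS hGS hw hwa
    have h1 := hS.connected.dist_triangle (u := b') (v := a) (w := b)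
    have h2 := hS.connected.dist_triangle (u := u) (v := b') (w := b)
    obtain rfl := h'.eq_of_between hS hGS hslide hw huv h (by omega)
    obtain ⟨-, rfl⟩ := h.unique hS h'
    omega
  refine hS.eq_of_le hT fun u v huv => ?_
  obtain ⟨a, b, h⟩ := exists_isMarked hT hG hp hS huv
  obtain rfl := key huv h
  obtain rfl := key huv.symm (h.symm fun g => hinv g huv)
  exact h.adj

end TreeAction

namespace GTree

open MulAction

variable {G : Type u} [Group G] {X Y : GTree G}

instance : MulAction G X.V where
  smul := X.smul
  one_smul := X.smul_one
  mul_smul := X.smul_mul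

/-- The restriction of a `G`-tree to a subgroup of `G`. -/
def restrict (X : GTree G) (H : Subgroup G) : GTree H where
  V := X.V
  graph := X.graph
  isTree := X.isTree
  smul h := X.smul h
  smul_one := X.smul_one
  smul_mul γ δ := X.smul_mul γ δ
  smul_adj γ := X.smul_adj γ
  no_inversions γ := X.no_inversions γ

theorem exists_smul_eq_of_unsplittable {H : Subgroup G} (hH : Unsplittable H) (X : GTree G) {g : G}
    (hg : g ∈ H) : ∃ x : X.V, g • x = x :=
  hH (X.restrict H) ⟨g, hg⟩

theorem exists_le_stabilizer_of_propertyFA {H : Subgroup G} (hH : PropertyFA H) (X : GTree G) :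
    ∃ x : X.V, H ≤ stabilizer G x := by
  obtain ⟨x, hx⟩ := hH (X.restrict H)
  exact ⟨x, fun g hg => hx ⟨g, hg⟩⟩

theorem Proper.not_stabilizer_le (hX : X.Proper) ⦃u v : X.V⦄ (huv : X.graph.Adj u v) :
    ¬ stabilizer G u ≤ stabilizer G v := fun h =>
  (hX ⟨(u, v), huv⟩).not_ge fun _ hg => ⟨hg, h hg⟩

theorem StronglySlideFree.exists_smul_eq (hX : X.StronglySlideFree) ⦃u v w : X.V⦄
    (huv : X.graph.Adj u v) (huw : X.graph.Adj u w)
    (h : stabilizer G u ⊓ stabilizer G v ≤ stabilizer G w) :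
    ∃ g : G, g • u = u ∧ g • v = w := by
  obtain ⟨g, hg⟩ := hX.2 ⟨(u, v), huv⟩ ⟨(u, w), huw⟩ rfl fun k hk => ⟨hk.1, h hk⟩
  have := congrArg Subtype.val hg
  exact ⟨g, congrArg Prod.fst this, congrArg Prod.snd this⟩

theorem StronglySlideFree.not_stabilizer_le (hX : X.StronglySlideFree) ⦃v w : X.V⦄
    (hvw : X.graph.Adj v w) : ¬ stabilizer G v ≤ stabilizer G w := by
  intro hle
  have hleaf : ∀ (g : G) (n : X.V), X.graph.Adj (g • v) n → n = g • w := by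
    intro g n hn
    have hn' := X.smul_adj g⁻¹ hn
    change X.graph.Adj (g⁻¹ • g • v) (g⁻¹ • n) at hn'
    rw [inv_smul_smul] at hn'
    obtain ⟨k, hkv, hkn⟩ := hX.exists_smul_eq hn' hvw (inf_le_left.trans hle)
    rw [← inv_smul_eq_iff, ← smul_left_cancel_iff k, hkn]
    exact (hle hkv).symm
  have hinv : X.IsInvariantSubtree {x | ∀ g : G, g • v ≠ x} := by
    refine ⟨⟨w, fun g hg => ?_⟩, fun k x hx g hg => hx (k⁻¹ * g) ?_, fun x hx y hy => ?_⟩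
    · exact X.no_inversions g v w hvw ⟨hg, (hleaf g v (hg ▸ hvw.symm)).symm⟩
    · rw [mul_smul, inv_smul_eq_iff]
      exact hg
    · induction hk : X.graph.dist x y generalizing x with
      | zero =>
        obtain rfl := X.isTree.connected.dist_eq_zero_iff.1 hk
        exact ⟨.nil, by simpa using hx⟩
      | succ k ih =>
        have hne : x ≠ y := by
          rintro rfl
          simp at hk
        obtain ⟨n, hn, hny⟩ := X.isTree.exists_adj_dist_add_one hne
        have hnS : ∀ g : G, g • v ≠ n := by
          rintro g rfl
          obtain ⟨m, hm, hmy⟩ := X.isTree.exists_adj_dist_add_one (hy g)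
          obtain rfl : m = x := (hleaf g m hm).trans (hleaf g x hn.symm).symm
          omega
        obtain ⟨p, hp⟩ := ih n hnS (by omega)
        refine ⟨.cons hn p, fun z hz => ?_⟩
        rw [SimpleGraph.Walk.support_cons, List.mem_cons] at hz
        rcases hz with rfl | hz
        exacts [hx, hp z hz]
  have hv : v ∈ {x | ∀ g : G, g • v ≠ x} := hX.1 _ hinv ▸ Set.mem_univ v
  exact hv 1 (one_smul G v)

theorem Cocompact.exists_finite_set_edges (hX : X.Cocompact) :
    ∃ F : Set (X.V × X.V), F.Finite ∧
      ∀ u v, X.graph.Adj u v → ∃ e ∈ F, ∃ g : G, g • e = (u, v) := by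
  have := hX.2
  refine ⟨Set.range fun q : Quot fun e f : X.Edge => ∃ γ, edgeSmul γ e = f => q.out.1,
    Set.finite_range _, fun u v huv => ⟨_, ⟨Quot.mk _ ⟨(u, v), huv⟩, rfl⟩, ?_⟩⟩
  have key : ∀ e f : X.Edge, Relation.EqvGen (fun e f : X.Edge => ∃ γ, edgeSmul γ e = f) e f →
      ∃ g : G, g • e.1 = f.1 := by
    intro e f h
    induction h with
    | rel e f h => exact h.imp fun g hg => congrArg Subtype.val hg
    | refl e => exact ⟨1, one_smul G e.1⟩
    | symm e f _ ih =>
      obtain ⟨g, hg⟩ := ih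
      exact ⟨g⁻¹, by rw [← hg, inv_smul_smul]⟩
    | trans e f k _ _ ih ih' =>
      obtain ⟨g, hg⟩ := ih
      obtain ⟨g', hg'⟩ := ih'
      exact ⟨g' * g, by rw [mul_smul, hg, hg']⟩
  exact key _ _ (Quot.eqvGen_exact (Quot.out_eq _))

theorem existsUnique_isGIso (hX : X.StronglySlideFree) (hY : Y.Proper)
    (hell : ∀ y : Y.V, ∀ g ∈ stabilizer G y, ∃ x : X.V, g • x = x)
    (hXY : ∀ x : X.V, ∃ y : Y.V, stabilizer G x ≤ stabilizer G y)
    (hYX : ∀ y : Y.V, ∃ x : X.V, stabilizer G y ≤ stabilizer G x) :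
    ∃! φ : X.V → Y.V, IsGIso X Y φ := by
  choose φ hφ using hXY
  have hφ' : ∀ x, stabilizer G (φ x) ≤ stabilizer G x := fun x =>
    TreeAction.stabilizer_le_of_stabilizer_le X.isTree X.smul_adj hX.not_stabilizer_le
      (hell (φ x)) (hφ x)
  have hsmul : ∀ (g : G) x, φ (g • x) = g • φ x := fun g x => by
    refine TreeAction.eq_of_stabilizer_le Y.isTree Y.smul_adj hY.not_stabilizer_le
      ((hφ' _).trans fun k hk => ?_)
    rw [TreeAction.mem_stabilizer_smul] at hk ⊢
    exact hφ x hk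
  have hbij : Function.Bijective φ := by
    refine ⟨fun x x' h => ?_, fun y => ?_⟩
    · exact TreeAction.eq_of_stabilizer_le X.isTree X.smul_adj hX.not_stabilizer_le
        ((hφ x).trans (h ▸ hφ' x'))
    · obtain ⟨x, hx⟩ := hYX y
      exact ⟨x, (TreeAction.eq_of_stabilizer_le Y.isTree Y.smul_adj hY.not_stabilizer_le
        (hx.trans (hφ x))).symm⟩
  have hgraph : X.graph = Y.graph.comap φ := by
    refine TreeAction.eq_of_slideFree X.isTree X.smul_adj hX.not_stabilizer_le
      (fun g u v => X.no_inversions g u v) hX.exists_smul_eq ?_ fun g u v huv => ?_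
    · exact (SimpleGraph.Iso.comap (Equiv.ofBijective φ hbij) Y.graph).isTree_iff.2 Y.isTree
    · rw [SimpleGraph.comap_adj, hsmul, hsmul]
      exact Y.smul_adj g huv
  refine ⟨φ, ⟨hbij, fun x y => by rw [hgraph, SimpleGraph.comap_adj], hsmul⟩, fun ψ hψ => ?_⟩
  funext x
  refine (TreeAction.eq_of_stabilizer_le Y.isTree Y.smul_adj hY.not_stabilizer_le
    ((hφ' x).trans fun g hg => ?_)).symm
  exact (hψ.2.2 g x).symm.trans (congrArg ψ hg)

end GTree

open GTree in
/-- Corollary 6.5: let `X` be a strongly slide-free `G`-tree and `Y` a proper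
`G`-tree, both cocompact, with all vertex stabilizers unsplittable.  If either
(1) one of the trees has (FA) vertex stabilizers, or (2) one of the trees is
locally finite, then there is a unique isomorphism of `G`-trees `X → Y`. -/
theorem rigidity_unsplittable {G : Type u} [Group G] (X Y : GTree G)
    (hXc : X.Cocompact) (hYc : Y.Cocompact)
    (hssf : X.StronglySlideFree) (hYp : Y.Proper)
    (hunsX : ∀ x : X.V, Unsplittable ↥(X.stab x))
    (hunsY : ∀ y : Y.V, Unsplittable ↥(Y.stab y))
    (hcase :
      ((∀ x : X.V, PropertyFA ↥(X.stab x)) ∨ (∀ y : Y.V, PropertyFA ↥(Y.stab y))) ∨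
      (X.LocallyFinite ∨ Y.LocallyFinite)) :
    ∃! φ : X.V → Y.V, IsGIso X Y φ := by
  have hell : ∀ x : X.V, ∀ g ∈ X.stab x, ∃ y : Y.V, g • y = y := fun x _ hg =>
    exists_smul_eq_of_unsplittable (hunsX x) Y hg
  have hell' : ∀ y : Y.V, ∀ g ∈ Y.stab y, ∃ x : X.V, g • x = x := fun y _ hg =>
    exists_smul_eq_of_unsplittable (hunsY y) X hg
  have hfix : (∀ x : X.V, ∃ y : Y.V, X.stab x ≤ Y.stab y) ∨
      ∀ y : Y.V, ∃ x : X.V, Y.stab y ≤ X.stab x := by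
    rcases hcase with (h | h) | h | h
    · exact .inl fun x => exists_le_stabilizer_of_propertyFA (h x) Y
    · exact .inr fun y => exists_le_stabilizer_of_propertyFA (h y) X
    · exact .inl (TreeAction.exists_fixed_of_locallyFinite X.isTree X.smul_adj Y.isTree Y.smul_adj
        hYp.not_stabilizer_le h hell)
    · exact .inr (TreeAction.exists_fixed_of_locallyFinite Y.isTree Y.smul_adj X.isTree X.smul_adj
        hssf.not_stabilizer_le h hell')
  obtain ⟨F, hF, hFX⟩ := hXc.exists_finite_set_edges
  obtain ⟨F', hF', hFY⟩ := hYc.exists_finite_set_edges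
  rcases hfix with h | h
  · exact existsUnique_isGIso hssf hYp hell' h
      (TreeAction.exists_fixed_of_forall_exists_fixed X.isTree X.smul_adj hssf.not_stabilizer_le
        Y.isTree Y.smul_adj hYp.not_stabilizer_le hF hFX hell' h)
  · exact existsUnique_isGIso hssf hYp hell'
      (TreeAction.exists_fixed_of_forall_exists_fixed Y.isTree Y.smul_adj hYp.not_stabilizer_le
        X.isTree X.smul_adj hssf.not_stabilizer_le hF' hFY hell h) h
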